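/- If the mixed-derivative degrees of freedom of a bicubic polynomial vanish at the two vertices of an edge, the normal derivative along that edge is a linear combination of only two basis functions: if p is a bicubic polynomial with ∂ₓ∂_yp(-1,-1) = ∂ₓ∂_yp(1,-1) = 0, then for all ξ ∈ ℝ, ∂_y p(ξ,-1) = ∂_yp(-1,-1)·ψ₀⁰(ξ) + ∂_yp(1,-1)·ψ₁⁰(ξ). -/

import Mathlib

/-- A bicubic polynomial: a real function on ℝ² that is polynomial of degree at
most 3 in each variable separately. -/
def Bicubic (p : ℝ → ℝ → ℝ) : Prop :=
  ∃ a : Fin 4 → Fin 4 → ℝ,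
    ∀ x y : ℝ, p x y = ∑ i : Fin 4, ∑ j : Fin 4, a i j * x ^ (i : ℕ) * y ^ (j : ℕ)

/-- Partial derivative in the first (x) variable. -/
noncomputable def pdx (p : ℝ → ℝ → ℝ) (x y : ℝ) : ℝ := deriv (fun t => p t y) x

/-- Partial derivative in the second (y) variable. -/
noncomputable def pdy (p : ℝ → ℝ → ℝ) (x y : ℝ) : ℝ := deriv (fun t => p x t) y

/-- Cubic Hermite basis function carrying the value dof at -1. -/
noncomputable def psi00 (ξ : ℝ) : ℝ := (ξ ^ 3 - 3 * ξ + 2) / 4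
/-- Cubic Hermite basis function carrying the value dof at 1. -/
noncomputable def psi10 (ξ : ℝ) : ℝ := (-ξ ^ 3 + 3 * ξ + 2) / 4

theorem deriv_cubic (a b c d x : ℝ) :
    deriv (fun t => a + b * t + c * t ^ 2 + d * t ^ 3) x = b + 2 * c * x + 3 * d * x ^ 2 := by
  have h := (((hasDerivAt_id x).const_mul b).const_add a).add
    ((hasDerivAt_pow 2 x).const_mul c) |>.add ((hasDerivAt_pow 3 x).const_mul d)
  refine Eq.trans h.deriv ?_
  norm_num
  ring

/-- The normal derivative of a bicubic polynomial along a horizontal line is a cubic. -/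
theorem Bicubic.exists_pdy_eq_cubic {p : ℝ → ℝ → ℝ} (hp : Bicubic p) (y : ℝ) :
    ∃ a b c d : ℝ, ∀ x, pdy p x y = a + b * x + c * x ^ 2 + d * x ^ 3 := by
  obtain ⟨a, ha⟩ := hp
  let e (i : Fin 4) : ℝ := a i 1 + 2 * a i 2 * y + 3 * a i 3 * y ^ 2
  refine ⟨e 0, e 1, e 2, e 3, fun x => ?_⟩
  let s (j : Fin 4) : ℝ := ∑ i, a i j * x ^ (i : ℕ)
  have hcubic : (fun t => p x t) = fun t => s 0 + s 1 * t + s 2 * t ^ 2 + s 3 * t ^ 3 := by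
    funext t
    simp [s, ha, Fin.sum_univ_four]
    ring
  rw [pdy, hcubic, deriv_cubic]
  simp [s, e, Fin.sum_univ_four]
  ring

/-- If the mixed-derivative degrees of freedom of a bicubic
polynomial vanish at the two vertices of the bottom edge, the normal derivative
along that edge is a combination of only the two value basis functions. -/
theorem bicubic_edge_normal_derivative_reduced (p : ℝ → ℝ → ℝ) (hp : Bicubic p)
    (h0 : pdx (pdy p) (-1) (-1) = 0) (h1 : pdx (pdy p) 1 (-1) = 0) (ξ : ℝ) :
    pdy p ξ (-1) = pdy p (-1) (-1) * psi00 ξ + pdy p 1 (-1) * psi10 ξ := by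
  obtain ⟨a, b, c, d, hc⟩ := hp.exists_pdy_eq_cubic (-1)
  simp only [pdx, hc, deriv_cubic] at h0 h1
  simp only [hc, psi00, psi10]
  linear_combination (ξ ^ 3 / 4 - ξ ^ 2 / 4 - ξ / 4 + 1 / 4) * h0 +
    (ξ ^ 3 / 4 + ξ ^ 2 / 4 - ξ / 4 - 1 / 4) * h1
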